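/- arXiv:1303.4266 — 5 statements merged into one kernel-verified Lean document; each statement's English description precedes it below -/
import Mathlib

section
/- Let h > 0, Q̂ > 0 and λ > 0, and let z be a standard Gaussian random variable. Then E_z[ φ_λ(z·√h; Q̂) ] = Q̂^{-1} · r_λ(h), where r_λ(h) = λ·√(h/(2π))·e^{−λ²/(2h)} − (λ² + h)·Q(λ/√h). -/
open MeasureTheory ProbabilityTheory Real

/-- The Gaussian Q-function `Q(x) = ∫_x^∞ (2π)^{−1/2} e^{−t²/2} dt`. -/
noncomputable def gaussQ (x : ℝ) : ℝ :=
  ∫ t in Set.Ioi x, (Real.sqrt (2 * Real.pi))⁻¹ * Real.exp (-t ^ 2 / 2)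

/-- The saddle-point function `φ_λ(h; Q̂)`: equal to `−(|h|−λ)²/(2Q̂)` for
`|h| > λ` and `0` for `|h| ≤ λ`. -/
noncomputable def phiFun (lam Qhat h : ℝ) : ℝ :=
  if lam < |h| then -(|h| - lam) ^ 2 / (2 * Qhat) else 0

/-- `r_λ(h) = λ·√(h/(2π))·e^{−λ²/(2h)} − (λ² + h)·Q(λ/√h)`. -/
noncomputable def rFun (lam h : ℝ) : ℝ :=
  lam * Real.sqrt (h / (2 * Real.pi)) * Real.exp (-lam ^ 2 / (2 * h))
    - (lam ^ 2 + h) * gaussQ (lam / Real.sqrt h)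

theorem integrable_mul_exp_neg_sq_div_two :
    Integrable fun x : ℝ => x * Real.exp (-x ^ 2 / 2) := by
  have := integrable_mul_exp_neg_mul_sq (b := 1 / 2) (by norm_num)
  refine this.congr (.of_forall fun x => ?_)
  beta_reduce
  congr 2
  ring

theorem integrable_exp_neg_sq_div_two :
    Integrable fun x : ℝ => Real.exp (-x ^ 2 / 2) := by
  have := integrable_exp_neg_mul_sq (b := 1 / 2) (by norm_num)
  refine this.congr (.of_forall fun x => ?_)
  beta_reduce
  congr 1
  ring

theorem integrable_sq_mul_exp_neg_sq_div_two :
    Integrable fun x : ℝ => x ^ 2 * Real.exp (-x ^ 2 / 2) := by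
  have := integrable_rpow_mul_exp_neg_mul_sq (b := 1 / 2) (by norm_num) (s := 2) (by norm_num)
  refine this.congr (.of_forall fun x => ?_)
  beta_reduce
  rw [Real.rpow_two]
  congr 2
  ring

/-- The truncated second moment of the Gaussian weight about the truncation point. -/
theorem integral_Ioi_sub_sq_mul_exp (a : ℝ) :
    ∫ x in Set.Ioi a, (x - a) ^ 2 * Real.exp (-x ^ 2 / 2)
      = -(a * Real.exp (-a ^ 2 / 2))
        + (1 + a ^ 2) * ∫ x in Set.Ioi a, Real.exp (-x ^ 2 / 2) := by
  have i0 := integrable_exp_neg_sq_div_two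
  have i1 := integrable_mul_exp_neg_sq_div_two
  have i2 := integrable_sq_mul_exp_neg_sq_div_two
  have hF : Integrable fun x : ℝ => (2 * a - x) * Real.exp (-x ^ 2 / 2) := by
    refine ((i0.const_mul (2 * a)).sub i1).congr (.of_forall fun x => ?_)
    simp only [Pi.sub_apply]
    ring
  have hsq : Integrable fun x : ℝ => (x - a) ^ 2 * Real.exp (-x ^ 2 / 2) := by
    refine ((i2.sub (i1.const_mul (2 * a))).add (i0.const_mul (a ^ 2))).congr
      (.of_forall fun x => ?_)
    simp only [Pi.sub_apply, Pi.add_apply]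
    ring
  have hF' := hsq.sub (i0.const_mul (1 + a ^ 2))
  have hderiv : ∀ x : ℝ, HasDerivAt (fun x : ℝ => (2 * a - x) * Real.exp (-x ^ 2 / 2))
      ((x - a) ^ 2 * Real.exp (-x ^ 2 / 2) - (1 + a ^ 2) * Real.exp (-x ^ 2 / 2)) x := by
    intro x
    have h1 : HasDerivAt (fun x : ℝ => -x ^ 2 / 2) (-x) x := by
      refine ((hasDerivAt_pow 2 x).fun_neg.div_const 2).congr_deriv ?_
      push_cast
      ring
    refine (((hasDerivAt_id' x).const_sub (2 * a)).fun_mul h1.exp).congr_deriv ?_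
    ring
  have hlim := tendsto_zero_of_hasDerivAt_of_integrableOn_Ioi (a := a)
    (fun x _ => hderiv x) hF'.integrableOn hF.integrableOn
  have hint := integral_Ioi_of_hasDerivAt_of_tendsto' (a := a)
    (fun x _ => hderiv x) hF'.integrableOn hlim
  rw [integral_sub hsq.integrableOn (i0.const_mul _).integrableOn, integral_const_mul] at hint
  linarith

/-- For `h > 0`, `Q̂ > 0`, `λ > 0` and a standard Gaussian `z`,
`E_z[ φ_λ(z·√h; Q̂) ] = Q̂⁻¹ · r_λ(h)`. -/
theorem gaussian_average_phi (h Qhat lam : ℝ) (hh : 0 < h) (hQ : 0 < Qhat)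
    (hlam : 0 < lam) :
    ∫ z, phiFun lam Qhat (z * Real.sqrt h) ∂(gaussianReal 0 1)
      = Qhat⁻¹ * rFun lam h := by
  obtain ⟨s, hs, rfl⟩ : ∃ s : ℝ, 0 < s ∧ h = s ^ 2 :=
    ⟨√h, Real.sqrt_pos.2 hh, (Real.sq_sqrt hh.le).symm⟩
  obtain ⟨a, ha, rfl⟩ : ∃ a : ℝ, 0 < a ∧ lam = a * s :=
    ⟨lam / s, div_pos hlam hs, (div_mul_cancel₀ _ hs.ne').symm⟩
  let c : ℝ := (√(2 * π))⁻¹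
  let k : ℝ := -(c * s ^ 2 / (2 * Qhat))
  let g : ℝ → ℝ := (Set.Ioi a).indicator fun x => k * ((x - a) ^ 2 * Real.exp (-x ^ 2 / 2))
  have hfun : ∀ z : ℝ, gaussianPDFReal 0 1 z • phiFun (a * s) Qhat (z * √(s ^ 2)) = g |z| := by
    intro z
    have hiff : a * s < |z| * s ↔ a < |z| := mul_lt_mul_iff_left₀ hs
    simp only [g, k, c, phiFun, Set.indicator_apply, Set.mem_Ioi, Real.sqrt_sq hs.le, abs_mul,
      abs_of_pos hs, hiff, gaussianPDFReal, smul_eq_mul, sq_abs, sub_zero, NNReal.coe_one,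
      mul_one, mul_ite, mul_zero]
    split_ifs
    · ring
    · rfl
  rw [integral_gaussianReal_eq_integral_smul one_ne_zero]
  simp_rw [hfun]
  rw [integral_comp_abs (f := g), setIntegral_indicator measurableSet_Ioi,
    Set.Ioi_inter_Ioi, max_eq_right ha.le, integral_const_mul, integral_Ioi_sub_sq_mul_exp]
  have hexp : -(a * s) ^ 2 / (2 * s ^ 2) = -a ^ 2 / 2 := by
    field_simp
  have hsqrt : √(s ^ 2 / (2 * π)) = s * c := by
    rw [Real.sqrt_div (sq_nonneg s), Real.sqrt_sq hs.le, div_eq_mul_inv]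
  rw [rFun, gaussQ, integral_const_mul, hexp, hsqrt, Real.sqrt_sq hs.le,
    mul_div_cancel_right₀ _ hs.ne']
  simp only [k]
  change _ = Qhat⁻¹ * (a * s * (s * c) * _ - _ * (c * _))
  field_simp
  ring
end

section
/- Let ω : ℝ → ℝ be twice continuously differentiable and suppose there exist constants C, c > 0 such that |ω(x)| + |ω'(x)| + |ω''(x)| ≤ C·e^{c|x|} for all x ∈ ℝ. Then the map a ↦ ∫ ω(t·√a) Dt is differentiable on (0, ∞) and its derivative equals (1/2)·∫ ω''(t·√a) Dt, where ω'' is the second derivative of ω. -/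
open MeasureTheory ProbabilityTheory Real

/-- The derivative of the standard Gaussian density. -/
lemma hasDerivAt_gaussianPDFReal_zero_one (t : ℝ) :
    HasDerivAt (gaussianPDFReal 0 1) (-t * gaussianPDFReal 0 1 t) t := by
  have h : HasDerivAt (fun x : ℝ => -(x - 0) ^ 2 / (2 * ((1 : NNReal) : ℝ))) (-t) t := by
    refine ((((hasDerivAt_id t).sub_const 0).pow 2).neg.div_const
      (2 * ((1 : NNReal) : ℝ))).congr_deriv ?_
    simp
    ring
  rw [gaussianPDFReal_def]
  refine (h.exp.const_mul (√(2 * π * ((1 : NNReal) : ℝ)))⁻¹).congr_deriv ?_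
  ring

/-- A function is integrable for a nondegenerate Gaussian measure iff its product with the
density is integrable for Lebesgue measure. -/
lemma integrable_gaussianReal_iff {μ : ℝ} {v : NNReal} (hv : v ≠ 0) {f : ℝ → ℝ} :
    Integrable f (gaussianReal μ v) ↔ Integrable (fun t => gaussianPDFReal μ v t * f t) := by
  rw [gaussianReal_of_var_ne_zero μ hv, integrable_withDensity_iff_integrable_smul'
    (measurable_gaussianPDF μ v) (ae_of_all _ fun _ => gaussianPDF_lt_top)]
  simp

/-- Gaussian integration by parts (Stein's identity). -/
lemma integral_id_mul_gaussianReal_eq_integral_deriv {g g' : ℝ → ℝ}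
    (hg : ∀ t, HasDerivAt g (g' t) t) (hg_int : Integrable g (gaussianReal 0 1))
    (hg'_int : Integrable g' (gaussianReal 0 1))
    (htg_int : Integrable (fun t => t * g t) (gaussianReal 0 1)) :
    ∫ t, t * g t ∂(gaussianReal 0 1) = ∫ t, g' t ∂(gaussianReal 0 1) := by
  have hz : ∫ t, gaussianPDFReal 0 1 t * (g' t - t * g t) = 0 := by
    refine integral_eq_zero_of_hasDerivAt_of_integrable
      (f := fun t => gaussianPDFReal 0 1 t * g t) (fun t => ?_)
      ((integrable_gaussianReal_iff one_ne_zero).1 (hg'_int.sub htg_int))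
      ((integrable_gaussianReal_iff one_ne_zero).1 hg_int)
    refine ((hasDerivAt_gaussianPDFReal_zero_one t).mul (hg t)).congr_deriv ?_
    ring
  have hs : ∫ t, (g' t - t * g t) ∂(gaussianReal 0 1) = 0 := by
    rw [integral_gaussianReal_eq_integral_smul one_ne_zero]
    simpa using hz
  rw [integral_sub hg'_int htg_int] at hs
  linarith

lemma integrable_exp_mul_abs_gaussianReal (μ : ℝ) (v : NNReal) (k : ℝ) :
    Integrable (fun t => exp (k * |t|)) (gaussianReal μ v) :=
  integrable_exp_mul_abs (X := fun t => t) (integrable_exp_mul_gaussianReal k)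
    (integrable_exp_mul_gaussianReal (-k))

/-- A continuous function of at most exponential growth is integrable for a Gaussian measure. -/
lemma integrable_gaussianReal_of_abs_le_exp {f : ℝ → ℝ} (hf : Continuous f) {μ : ℝ} {v : NNReal}
    {K k : ℝ} (h : ∀ t, |f t| ≤ K * exp (k * |t|)) : Integrable f (gaussianReal μ v) :=
  ((integrable_exp_mul_abs_gaussianReal μ v k).const_mul K).mono' hf.aestronglyMeasurable
    (ae_of_all _ h)

lemma abs_mul_le_exp {y K k t : ℝ} (h : |y| ≤ K * exp (k * |t|)) :
    |t * y| ≤ K * exp ((k + 1) * |t|) := by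
  have ht : |t| ≤ exp |t| := by linarith [add_one_le_exp |t|]
  calc |t * y| = |t| * |y| := abs_mul t y
    _ ≤ exp |t| * (K * exp (k * |t|)) := by gcongr
    _ = K * exp ((k + 1) * |t|) := by
      rw [add_mul, one_mul, exp_add]
      ring

lemma abs_comp_mul_sqrt_le {f : ℝ → ℝ} {C c : ℝ} (hC : 0 ≤ C) (hc : 0 ≤ c)
    (h : ∀ x, |f x| ≤ C * exp (c * |x|)) {x b : ℝ} (hxb : x ≤ b) (t : ℝ) :
    |f (t * √x)| ≤ C * exp (c * √b * |t|) := by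
  refine (h _).trans ?_
  rw [abs_mul, abs_of_nonneg (sqrt_nonneg x), mul_assoc, mul_comm |t|]
  gcongr

/-- Gaussian smoothing identity: if `ω : ℝ → ℝ` is twice
continuously differentiable with `|ω| + |ω'| + |ω''| ≤ C·e^{c|x|}`, then
`a ↦ ∫ ω(t·√a) Dt` (with `Dt` the standard Gaussian measure) is differentiable
on `(0, ∞)` with derivative `(1/2)·∫ ω''(t·√a) Dt`. -/
theorem gaussian_smoothing_deriv (ω : ℝ → ℝ) (hω : ContDiff ℝ 2 ω)
    (C c : ℝ) (hC : 0 < C) (hc : 0 < c)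
    (hgrowth : ∀ x : ℝ,
      |ω x| + |deriv ω x| + |deriv (deriv ω) x| ≤ C * Real.exp (c * |x|)) :
    ∀ a : ℝ, 0 < a →
      HasDerivAt (fun a : ℝ => ∫ t, ω (t * Real.sqrt a) ∂(gaussianReal 0 1))
        ((1 / 2) * ∫ t, deriv (deriv ω) (t * Real.sqrt a) ∂(gaussianReal 0 1))
        a := by
  intro a ha
  have h₀ : ∀ x, |ω x| ≤ C * exp (c * |x|) := fun x => by
    linarith [hgrowth x, abs_nonneg (deriv ω x), abs_nonneg (deriv (deriv ω) x)]
  have h₁ : ∀ x, |deriv ω x| ≤ C * exp (c * |x|) := fun x => by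
    linarith [hgrowth x, abs_nonneg (ω x), abs_nonneg (deriv (deriv ω) x)]
  have h₂ : ∀ x, |deriv (deriv ω) x| ≤ C * exp (c * |x|) := fun x => by
    linarith [hgrowth x, abs_nonneg (ω x), abs_nonneg (deriv ω x)]
  have hω' : ContDiff ℝ 1 (deriv ω) := hω.deriv'
  have hd : ∀ x, HasDerivAt ω (deriv ω x) x := fun x =>
    (hω.differentiable (by norm_num) x).hasDerivAt
  have hd' : ∀ x, HasDerivAt (deriv ω) (deriv (deriv ω) x) x := fun x =>
    (hω'.differentiable (by norm_num) x).hasDerivAt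
  have hcont : Continuous ω := hω.continuous
  have hcont' : Continuous (deriv ω) := hω'.continuous
  have hcont'' : Continuous (deriv (deriv ω)) := hω'.continuous_deriv le_rfl
  have hsa : √a ≠ 0 := (sqrt_pos.2 ha).ne'
  obtain ⟨-, hder⟩ := hasDerivAt_integral_of_dominated_loc_of_deriv_le (𝕜 := ℝ)
    (μ := gaussianReal 0 1) (x₀ := a) (s := Set.Ioo (a / 2) (2 * a))
    (F := fun x t => ω (t * √x)) (F' := fun x t => 1 / (2 * √x) * (t * deriv ω (t * √x)))
    (bound := fun t => 1 / (2 * √(a / 2)) * (C * exp ((c * √(2 * a) + 1) * |t|)))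
    (Ioo_mem_nhds (by linarith) (by linarith))
    (Filter.Eventually.of_forall fun x => by fun_prop)
    (integrable_gaussianReal_of_abs_le_exp (by fun_prop)
      (abs_comp_mul_sqrt_le hC.le hc.le h₀ le_rfl))
    (by fun_prop)
    (ae_of_all _ fun t x hx => by
      have hx₀ : 0 < √(a / 2) := sqrt_pos.2 (by linarith)
      have hle : √(a / 2) ≤ √x := sqrt_le_sqrt hx.1.le
      rw [norm_eq_abs, abs_mul, abs_of_nonneg (by positivity : 0 ≤ 1 / (2 * √x))]
      gcongr
      exact abs_mul_le_exp (abs_comp_mul_sqrt_le hC.le hc.le h₁ hx.2.le t))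
    (((integrable_exp_mul_abs_gaussianReal 0 1 _).const_mul C).const_mul _)
    (ae_of_all _ fun t x hx => by
      have hx₀ : x ≠ 0 := by linarith [hx.1]
      refine ((hd (t * √x)).comp x ((hasDerivAt_sqrt hx₀).const_mul t)).congr_deriv ?_
      ring)
  have hstein : ∫ t, t * deriv ω (t * √a) ∂(gaussianReal 0 1) =
      ∫ t, deriv (deriv ω) (t * √a) * √a ∂(gaussianReal 0 1) := by
    have hb := abs_comp_mul_sqrt_le hC.le hc.le h₁ (le_refl a)
    refine integral_id_mul_gaussianReal_eq_integral_deriv (fun t => ?_)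
      (integrable_gaussianReal_of_abs_le_exp (by fun_prop) hb)
      ((integrable_gaussianReal_of_abs_le_exp (by fun_prop)
        (abs_comp_mul_sqrt_le hC.le hc.le h₂ le_rfl)).mul_const _)
      (integrable_gaussianReal_of_abs_le_exp (by fun_prop) fun t => abs_mul_le_exp (hb t))
    refine ((hd' (t * √a)).comp t ((hasDerivAt_id t).mul_const √a)).congr_deriv ?_
    ring
  refine hder.congr_deriv ?_
  rw [integral_const_mul, hstein, integral_mul_const]
  field_simp
end

section
/- Let Z be a random variable with Z > 0 almost surely, and suppose there exists ε > 0 such that E[Z^ε] < ∞ and E[Z^{−ε}] < ∞. Then E[|ln Z|] < ∞, the function u ↦ E[Z^u] is finite for u ∈ [0, ε], and the function u ↦ ln E[Z^u] is right-differentiable at u = 0 with right derivative equal to E[ln Z]; that is, lim_{u → 0⁺} (ln E[Z^u])/u = E[ln Z]. -/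
open MeasureTheory ProbabilityTheory Filter

/-- Almost everywhere, the real powers of a positive function are exponentials of its logarithm. -/
lemma rpow_ae_eq_exp_mul_log {Ω : Type*} [MeasurableSpace Ω] {μ : Measure Ω} {Z : Ω → ℝ}
    (hpos : ∀ᵐ ω ∂μ, 0 < Z ω) (u : ℝ) :
    (fun ω => Z ω ^ u) =ᵐ[μ] fun ω => Real.exp (u * Real.log (Z ω)) := by
  filter_upwards [hpos] with ω hω
  rw [Real.rpow_def_of_pos hω, mul_comm]

/-- The rigorous starting identity of the replica method:
if `Z > 0` a.s. and `E[Z^ε], E[Z^{−ε}] < ∞` for some `ε > 0`, then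
`E[|ln Z|] < ∞`, `u ↦ E[Z^u]` is finite on `[0, ε]`, and `u ↦ ln E[Z^u]` is
right-differentiable at `u = 0` with right derivative `E[ln Z]`; i.e.
`lim_{u→0⁺} (ln E[Z^u])/u = E[ln Z]`. -/
theorem replica_log_derivative {Ω : Type*} [MeasureSpace Ω]
    [IsProbabilityMeasure (ℙ : Measure Ω)]
    (Z : Ω → ℝ) (hmeas : Measurable Z) (hpos : ∀ᵐ ω, 0 < Z ω)
    (ε : ℝ) (hε : 0 < ε)
    (hplus : Integrable fun ω => Z ω ^ ε)
    (hminus : Integrable fun ω => Z ω ^ (-ε)) :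
    Integrable (fun ω => |Real.log (Z ω)|) ∧
    (∀ u ∈ Set.Icc (0 : ℝ) ε, Integrable fun ω => Z ω ^ u) ∧
    HasDerivWithinAt (fun u : ℝ => Real.log (∫ ω, Z ω ^ u))
      (∫ ω, Real.log (Z ω)) (Set.Ici 0) 0 ∧
    Tendsto (fun u : ℝ => Real.log (∫ ω, Z ω ^ u) / u)
      (nhdsWithin 0 (Set.Ioi 0)) (nhds (∫ ω, Real.log (Z ω))) := by
  let X : Ω → ℝ := fun ω => Real.log (Z ω)
  have hexp (u : ℝ) : (Integrable fun ω => Z ω ^ u) ↔ u ∈ integrableExpSet X ℙ :=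
    integrable_congr (rpow_ae_eq_exp_mul_log hpos u)
  have hIcc : Set.Icc (-ε) ε ⊆ integrableExpSet X ℙ :=
    convex_integrableExpSet.ordConnected.out ((hexp _).1 hminus) ((hexp _).1 hplus)
  have h0 : (0 : ℝ) ∈ interior (integrableExpSet X ℙ) :=
    mem_interior_iff_mem_nhds.2 (mem_of_superset (Icc_mem_nhds (by linarith) hε) hIcc)
  have hcgf : (fun u : ℝ => Real.log (∫ ω, Z ω ^ u)) = cgf X ℙ := by
    funext u
    exact congrArg Real.log (integral_congr_ae (rpow_ae_eq_exp_mul_log hpos u))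
  have hderiv : HasDerivAt (fun u : ℝ => Real.log (∫ ω, Z ω ^ u))
      (∫ ω, Real.log (Z ω)) 0 := by
    have h := (analyticAt_cgf h0).differentiableAt.hasDerivAt
    rw [deriv_cgf_zero h0] at h
    simpa [hcgf, X] using h
  refine ⟨(integrable_of_mem_interior_integrableExpSet h0).abs,
    fun u hu => (hexp u).2 (hIcc ⟨by linarith [hu.1], hu.2⟩), hderiv.hasDerivWithinAt, ?_⟩
  refine hderiv.tendsto_slope_zero_right.congr fun u => ?_
  simp [div_eq_inv_mul]
end

section
/- Let F : ℝ^N → ℝ be a convex function with a unique global minimizer x* ∈ ℝ^N, and suppose e^{−F} is Lebesgue integrable on ℝ^N. Then for every β ≥ 1 the Gibbs mean ⟨x⟩_β = (∫_{ℝ^N} x·e^{−β F(x)} dx) / (∫_{ℝ^N} e^{−β F(x)} dx) is well defined, and ⟨x⟩_β converges to x* as β → ∞. -/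
open MeasureTheory Filter

section GibbsMean

variable {E : Type*} [NormedAddCommGroup E] [NormedSpace ℝ E] [FiniteDimensional ℝ E]
  {F : E → ℝ} {x₀ : E}

/-- A convex function on a finite-dimensional space with a strict global minimum at `x₀` grows at
least linearly outside every ball centered at `x₀`. -/
theorem ConvexOn.exists_linear_growth (hF : ConvexOn ℝ Set.univ F)
    (hmin : ∀ x, x ≠ x₀ → F x₀ < F x) {δ : ℝ} (hδ : 0 < δ) :
    ∃ c > 0, ∀ x, δ ≤ ‖x - x₀‖ → F x₀ + c * ‖x - x₀‖ ≤ F x := by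
  obtain ⟨m, hm, hm_le⟩ := (isCompact_sphere x₀ δ).exists_forall_le'
    hF.locallyLipschitz.continuous.continuousOn
    fun x hx => hmin x (Metric.ne_of_mem_sphere hx hδ.ne')
  refine ⟨(m - F x₀) / δ, div_pos (sub_pos.2 hm) hδ, fun x hx => ?_⟩
  have hr : 0 < ‖x - x₀‖ := hδ.trans_le hx
  set t : ℝ := δ / ‖x - x₀‖ with ht
  have ht0 : 0 < t := div_pos hδ hr
  have ht1 : t ≤ 1 := (div_le_one hr).2 hx
  have hsphere : (1 - t) • x₀ + t • x ∈ Metric.sphere x₀ δ := by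
    have h : (1 - t) • x₀ + t • x - x₀ = t • (x - x₀) := by module
    rw [mem_sphere_iff_norm, h, norm_smul, Real.norm_of_nonneg ht0.le, ht,
      div_mul_cancel₀ _ hr.ne']
  have hle : m ≤ (1 - t) * F x₀ + t * F x := (hm_le _ hsphere).trans
    (hF.2 (Set.mem_univ _) (Set.mem_univ _) (sub_nonneg.2 ht1) ht0.le (by ring))
  have key : m - F x₀ ≤ t * (F x - F x₀) := by linarith
  have : (m - F x₀) / δ * ‖x - x₀‖ ≤ F x - F x₀ := by
    calc (m - F x₀) / δ * ‖x - x₀‖ = (m - F x₀) / t := by rw [ht]; field_simp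
      _ ≤ F x - F x₀ := by rw [div_le_iff₀ ht0]; linarith
  linarith

variable [MeasurableSpace E] [BorelSpace E] {μ : Measure E} [μ.IsAddHaarMeasure]

theorem integrable_one_add_norm_mul_exp_neg (hF : ConvexOn ℝ Set.univ F)
    (hmin : ∀ x, x ≠ x₀ → F x₀ < F x) {β : ℝ} (hβ : 0 < β) :
    Integrable (fun x => (1 + ‖x - x₀‖) * Real.exp (-(β * F x))) μ := by
  have hcont := hF.locallyLipschitz.continuous
  obtain ⟨c, hc, hgrowth⟩ := hF.exists_linear_growth hmin one_pos
  have hglobal : ∀ x, F x₀ + c * (1 + ‖x - x₀‖) - 2 * c ≤ F x := fun x => by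
    rcases le_total 1 ‖x - x₀‖ with h | h
    · linarith [hgrowth x h]
    · have : F x₀ ≤ F x := by
        rcases eq_or_ne x x₀ with rfl | hx
        exacts [le_rfl, (hmin x hx).le]
      nlinarith
  set k : ℕ := Module.finrank ℝ E + 2 with hk
  have hdom : Integrable (fun x : E => (1 + ‖x - x₀‖) ^ (-(Module.finrank ℝ E + 1 : ℝ))) μ :=
    (integrable_one_add_norm (μ := μ) (by linarith)).comp_sub_right x₀
  refine (hdom.const_mul (Real.exp (-(β * (F x₀ - 2 * c))) * (k.factorial / (β * c) ^ k))).mono'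
    (by fun_prop) (ae_of_all _ fun x => ?_)
  set s : ℝ := 1 + ‖x - x₀‖ with hs
  have hs0 : 0 < s := by positivity
  have hexp : Real.exp (-(β * c * s)) ≤ k.factorial / (β * c) ^ k / s ^ k := by
    have h := Real.pow_div_factorial_le_exp (β * c * s) (by positivity) k
    calc Real.exp (-(β * c * s)) = (Real.exp (β * c * s))⁻¹ := Real.exp_neg _
      _ ≤ ((β * c * s) ^ k / k.factorial)⁻¹ := inv_anti₀ (by positivity) h
      _ = k.factorial / (β * c) ^ k / s ^ k := by rw [mul_pow]; field_simp
  have hpow : s * (1 / s ^ k) = s ^ (-(Module.finrank ℝ E + 1 : ℝ)) := by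
    rw [Real.rpow_neg hs0.le, show (Module.finrank ℝ E + 1 : ℝ) = (Module.finrank ℝ E + 1 : ℕ) by
      push_cast; rfl, Real.rpow_natCast, hk]
    field_simp
    ring
  rw [Real.norm_of_nonneg (by positivity)]
  calc s * Real.exp (-(β * F x))
      ≤ s * Real.exp (-(β * (F x₀ - 2 * c)) + -(β * c * s)) := by
        gcongr
        nlinarith [hglobal x]
    _ = s * (Real.exp (-(β * (F x₀ - 2 * c))) * Real.exp (-(β * c * s))) := by rw [Real.exp_add]
    _ ≤ s * (Real.exp (-(β * (F x₀ - 2 * c))) * (k.factorial / (β * c) ^ k / s ^ k)) := by gcongr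
    _ = Real.exp (-(β * (F x₀ - 2 * c))) * (k.factorial / (β * c) ^ k) * (s * (1 / s ^ k)) := by
        ring
    _ = _ := by rw [hpow]

theorem integrable_exp_neg_of_convexOn (hF : ConvexOn ℝ Set.univ F)
    (hmin : ∀ x, x ≠ x₀ → F x₀ < F x) {β : ℝ} (hβ : 0 < β) :
    Integrable (fun x => Real.exp (-(β * F x))) μ := by
  have hcont := hF.locallyLipschitz.continuous
  refine (integrable_one_add_norm_mul_exp_neg hF hmin hβ).mono' (by fun_prop)
    (ae_of_all _ fun x => ?_)
  rw [Real.norm_of_nonneg (Real.exp_nonneg _)]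
  exact le_mul_of_one_le_left (Real.exp_nonneg _) (by simp)

theorem integrable_exp_neg_smul_sub_of_convexOn (hF : ConvexOn ℝ Set.univ F)
    (hmin : ∀ x, x ≠ x₀ → F x₀ < F x) {β : ℝ} (hβ : 0 < β) :
    Integrable (fun x => Real.exp (-(β * F x)) • (x - x₀)) μ := by
  have hcont := hF.locallyLipschitz.continuous
  refine (integrable_one_add_norm_mul_exp_neg hF hmin hβ).mono'
    (Continuous.aestronglyMeasurable (by fun_prop)) (ae_of_all _ fun x => ?_)
  rw [norm_smul, Real.norm_of_nonneg (Real.exp_nonneg _), mul_comm]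
  gcongr
  simp

theorem integrable_exp_neg_smul_of_convexOn (hF : ConvexOn ℝ Set.univ F)
    (hmin : ∀ x, x ≠ x₀ → F x₀ < F x) {β : ℝ} (hβ : 0 < β) :
    Integrable (fun x => Real.exp (-(β * F x)) • x) μ := by
  refine ((integrable_exp_neg_smul_sub_of_convexOn hF hmin hβ).add
    ((integrable_exp_neg_of_convexOn hF hmin hβ).smul_const x₀)).congr (ae_of_all _ fun x => ?_)
  simp [smul_sub]

theorem norm_integral_exp_neg_smul_sub_le (hF : ConvexOn ℝ Set.univ F)
    (hmin : ∀ x, x ≠ x₀ → F x₀ < F x) {ε c : ℝ} (hε : 0 ≤ ε) (hc : 0 ≤ c)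
    (hgrowth : ∀ x, ε ≤ ‖x - x₀‖ → F x₀ + c * ‖x - x₀‖ ≤ F x) {β : ℝ} (hβ : 1 ≤ β) :
    ‖∫ x, Real.exp (-(β * F x)) • (x - x₀) ∂μ‖ ≤ ε * ∫ x, Real.exp (-(β * F x)) ∂μ +
      Real.exp (-((β - 1) * (F x₀ + c * ε))) *
        ∫ x, ‖Real.exp (-(1 * F x)) • (x - x₀)‖ ∂μ := by
  have hint := integrable_exp_neg_of_convexOn (μ := μ) hF hmin (one_pos.trans_le hβ)
  have hint' := (integrable_exp_neg_smul_sub_of_convexOn (μ := μ) hF hmin one_pos).norm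
  rw [← integral_const_mul, ← integral_const_mul,
    ← integral_add (hint.const_mul _) (hint'.const_mul _)]
  refine norm_integral_le_of_norm_le ((hint.const_mul _).add (hint'.const_mul _))
    (ae_of_all _ fun x => ?_)
  simp only [norm_smul, Real.norm_of_nonneg (Real.exp_nonneg _)]
  rcases le_total ‖x - x₀‖ ε with h | h
  · rw [mul_comm]
    exact (mul_le_mul_of_nonneg_right h (Real.exp_nonneg _)).trans
      (le_add_of_nonneg_right (by positivity))
  · refine le_trans ?_ (le_add_of_nonneg_left (by positivity))
    rw [← mul_assoc, ← Real.exp_add]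
    gcongr
    have : F x₀ + c * ε ≤ F x := le_trans (by gcongr) (hgrowth x h)
    nlinarith

/-- Laplace-type lower bound for the partition function. -/
theorem exists_mul_exp_le_integral_exp_neg (hF : ConvexOn ℝ Set.univ F)
    (hmin : ∀ x, x ≠ x₀ → F x₀ < F x) {η : ℝ} (hη : 0 < η) :
    ∃ V > 0, ∀ β > 0, V * Real.exp (-(β * (F x₀ + η))) ≤ ∫ x, Real.exp (-(β * F x)) ∂μ := by
  have hcont := hF.locallyLipschitz.continuous
  obtain ⟨r, hr, hball⟩ := Metric.eventually_nhds_iff_ball.1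
    (hcont.continuousAt.eventually_lt_const (lt_add_of_pos_right (F x₀) hη))
  refine ⟨μ.real (Metric.ball x₀ r),
    ENNReal.toReal_pos (Metric.measure_ball_pos μ x₀ hr).ne' measure_ball_lt_top.ne,
    fun β hβ => ?_⟩
  have hint := integrable_exp_neg_of_convexOn (μ := μ) hF hmin hβ
  calc μ.real (Metric.ball x₀ r) * Real.exp (-(β * (F x₀ + η)))
      = ∫ _ in Metric.ball x₀ r, Real.exp (-(β * (F x₀ + η))) ∂μ := by simp
    _ ≤ ∫ x in Metric.ball x₀ r, Real.exp (-(β * F x)) ∂μ := by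
        refine setIntegral_mono_on (integrableOn_const measure_ball_lt_top.ne) hint.integrableOn
          measurableSet_ball fun x hx => ?_
        have := hball x hx
        gcongr
    _ ≤ ∫ x, Real.exp (-(β * F x)) ∂μ :=
        setIntegral_le_integral hint (ae_of_all _ fun x => Real.exp_nonneg _)

theorem integral_exp_neg_pos_of_convexOn (hF : ConvexOn ℝ Set.univ F)
    (hmin : ∀ x, x ≠ x₀ → F x₀ < F x) {β : ℝ} (hβ : 0 < β) :
    0 < ∫ x, Real.exp (-(β * F x)) ∂μ :=
  integral_exp_pos (integrable_exp_neg_of_convexOn hF hmin hβ)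

theorem tendsto_gibbs_mean_of_convexOn (hF : ConvexOn ℝ Set.univ F)
    (hmin : ∀ x, x ≠ x₀ → F x₀ < F x) :
    Tendsto (fun β : ℝ => (∫ x, Real.exp (-(β * F x)) ∂μ)⁻¹ • ∫ x, Real.exp (-(β * F x)) • x ∂μ)
      atTop (nhds x₀) := by
  refine Metric.tendsto_nhds.2 fun δ hδ => ?_
  set ε := δ / 2 with hεδ
  have hε : 0 < ε := half_pos hδ
  obtain ⟨c, hc, hgrowth⟩ := hF.exists_linear_growth hmin hε
  have hη : 0 < c * ε / 2 := by positivity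
  obtain ⟨V, hV, hZ⟩ := exists_mul_exp_le_integral_exp_neg (μ := μ) hF hmin hη
  set K := ∫ x, ‖Real.exp (-(1 * F x)) • (x - x₀)‖ ∂μ with hK
  have hK0 : 0 ≤ K := integral_nonneg fun x => norm_nonneg _
  have hlim : Tendsto (fun β : ℝ => K / V * Real.exp (F x₀ + c * ε) *
      Real.exp (-(β * (c * ε / 2)))) atTop (nhds 0) := by
    have := (Real.tendsto_exp_neg_atTop_nhds_zero.comp
      (tendsto_id.atTop_mul_const hη)).const_mul (K / V * Real.exp (F x₀ + c * ε))
    simpa using this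
  filter_upwards [eventually_ge_atTop 1, hlim.eventually_lt_const hε] with β hβ hsmall
  have hβ0 : 0 < β := one_pos.trans_le hβ
  set Z := ∫ x, Real.exp (-(β * F x)) ∂μ with hZdef
  have hZ0 : 0 < Z := integral_exp_neg_pos_of_convexOn hF hmin hβ0
  have hsub : Z⁻¹ • ∫ x, Real.exp (-(β * F x)) • x ∂μ - x₀ =
      Z⁻¹ • ∫ x, Real.exp (-(β * F x)) • (x - x₀) ∂μ := by
    simp_rw [smul_sub]
    rw [integral_sub (integrable_exp_neg_smul_of_convexOn hF hmin hβ0)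
      ((integrable_exp_neg_of_convexOn hF hmin hβ0).smul_const x₀), integral_smul_const,
      smul_sub, ← hZdef, inv_smul_smul₀ hZ0.ne']
  have htail : Real.exp (-((β - 1) * (F x₀ + c * ε))) * K ≤
      K / V * Real.exp (F x₀ + c * ε) * Real.exp (-(β * (c * ε / 2))) * Z := by
    calc Real.exp (-((β - 1) * (F x₀ + c * ε))) * K
        = K / V * (Real.exp (F x₀ + c * ε) * Real.exp (-(β * (c * ε / 2)))) *
            (V * Real.exp (-(β * (F x₀ + c * ε / 2)))) := by
          rw [show -((β - 1) * (F x₀ + c * ε)) = F x₀ + c * ε + -(β * (c * ε / 2)) +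
            -(β * (F x₀ + c * ε / 2)) by ring, Real.exp_add, Real.exp_add]
          field_simp
      _ ≤ K / V * (Real.exp (F x₀ + c * ε) * Real.exp (-(β * (c * ε / 2)))) * Z := by
          gcongr
          exact hZ β hβ0
      _ = _ := by ring
  have hbound := norm_integral_exp_neg_smul_sub_le (μ := μ) hF hmin hε.le hc.le hgrowth hβ
  rw [dist_eq_norm, hsub, norm_smul, norm_inv, Real.norm_of_nonneg hZ0.le, inv_mul_lt_iff₀ hZ0]
  nlinarith

end GibbsMean

/-- Zero-temperature limit of the Gibbs mean: if `F` is
convex with a unique global minimizer `x*` and `e^{−F}` is integrable, then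
for every `β ≥ 1` the Gibbs mean
`⟨x⟩_β = (∫ x·e^{−βF(x)} dx)/(∫ e^{−βF(x)} dx)` is well defined and
`⟨x⟩_β → x*` as `β → ∞`. -/
theorem gibbs_mean_zero_temperature_limit (N : ℕ) (hN : 1 ≤ N)
    (F : (Fin N → ℝ) → ℝ) (hconv : ConvexOn ℝ Set.univ F)
    (xstar : Fin N → ℝ)
    (hmin : ∀ x, F xstar ≤ F x)
    (huniq : ∀ x, (∀ y, F x ≤ F y) → x = xstar)
    (hint : Integrable fun x : Fin N → ℝ => Real.exp (-F x)) :
    (∀ β : ℝ, 1 ≤ β →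
      Integrable (fun x : Fin N → ℝ => Real.exp (-(β * F x)) • x) ∧
      Integrable (fun x : Fin N → ℝ => Real.exp (-(β * F x))) ∧
      0 < ∫ x : Fin N → ℝ, Real.exp (-(β * F x))) ∧
    Tendsto
      (fun β : ℝ =>
        (∫ x : Fin N → ℝ, Real.exp (-(β * F x)))⁻¹ •
          ∫ x : Fin N → ℝ, Real.exp (-(β * F x)) • x)
      atTop (nhds xstar) := by
  have hstrict : ∀ x, x ≠ xstar → F xstar < F x := fun x hx =>
    (hmin x).lt_of_ne fun h => hx (huniq x fun y => h ▸ hmin y)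
  refine ⟨fun β hβ => ?_, tendsto_gibbs_mean_of_convexOn hconv hstrict⟩
  have hβ0 : 0 < β := one_pos.trans_le hβ
  exact ⟨integrable_exp_neg_smul_of_convexOn hconv hstrict hβ0,
    integrable_exp_neg_of_convexOn hconv hstrict hβ0,
    integral_exp_neg_pos_of_convexOn hconv hstrict hβ0⟩
end

section
/- Let u > 0, χ > 0, σ_w² > 0 and ρ ∈ [0, 1]. Let t be a standard Gaussian random variable and let w be an independent random variable with Bernoulli–Gaussian distribution (1−ρ)·δ₀ + ρ·N(0, σ_w²). Then E[ min( (t·√u + w)²/χ², 1 ) ] = (1−ρ)·[ s(χ/√u) + 2Q(χ/√u) ] + ρ·[ s(χ/√(u+σ_w²)) + 2Q(χ/√(u+σ_w²)) ]. -/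
open MeasureTheory ProbabilityTheory Real
open scoped NNReal

/-- `s(x) = x^{−2}(1 − 2Q(x)) − √(2/(πx²))·e^{−x²/2}`. -/
noncomputable def sFun (x : ℝ) : ℝ :=
  (1 / x ^ 2) * (1 - 2 * gaussQ x)
    - Real.sqrt (2 / (Real.pi * x ^ 2)) * Real.exp (-x ^ 2 / 2)

/-- The Bernoulli–Gaussian (sparse) distribution `(1−ρ)·δ₀ + ρ·N(0, σ²)`. -/
noncomputable def bernoulliGaussian (ρ : ℝ) (σ2 : ℝ≥0) : Measure ℝ :=
  ENNReal.ofReal (1 - ρ) • Measure.dirac 0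
    + ENNReal.ofReal ρ • gaussianReal 0 σ2

theorem integral_min_sq_div_gaussianReal_zero_one {a : ℝ} (ha : 0 < a) :
    ∫ z, min (z ^ 2 / a ^ 2) 1 ∂gaussianReal 0 1 = sFun a + 2 * gaussQ a := by
  set φ : ℝ → ℝ := fun x ↦ (√(2 * π))⁻¹ * exp (-x ^ 2 / 2) with hφ
  have hpdf : ∀ x, gaussianPDFReal 0 1 x = φ x := fun x ↦ by simp [gaussianPDFReal, hφ]
  have hφint : Integrable φ :=
    (integrable_gaussianPDFReal 0 1).congr (.of_forall hpdf)
  have hφc : Continuous φ := by fun_prop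
  have hφeven : ∀ x, φ |x| = φ x := fun x ↦ by simp [hφ]
  have hφhalf : ∫ x in Set.Ioi 0, φ x = 1 / 2 := by
    have h1 : ∫ x, φ x = 1 := by
      simpa only [hpdf] using integral_gaussianPDFReal_eq_one 0 (v := 1) one_ne_zero
    have h2 := integral_comp_abs (f := φ)
    simp only [hφeven] at h2
    linarith
  have hφa : ∫ x in (0)..a, φ x = 1 / 2 - gaussQ a := by
    rw [← hφhalf, gaussQ,
      intervalIntegral.integral_Ioi_sub_Ioi hφint.integrableOn ha.le,
      intervalIntegral.integral_of_le ha.le]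
  have hderiv : ∀ x, HasDerivAt (fun x ↦ -(x * φ x)) (x ^ 2 * φ x - φ x) x := by
    intro x
    have h1 : HasDerivAt (fun x : ℝ ↦ -x ^ 2 / 2) (-x) x :=
      (((hasDerivAt_id x).pow 2).neg.div_const 2).congr_deriv (by simp; ring)
    exact ((hasDerivAt_id x).mul (h1.exp.const_mul (√(2 * π))⁻¹)).neg.congr_deriv
      (by simp [hφ]; ring)
  have hsq : ∫ x in (0)..a, x ^ 2 * φ x = 1 / 2 - gaussQ a - a * φ a := by
    have h := intervalIntegral.integral_eq_sub_of_hasDerivAt (a := 0) (b := a)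
      (fun x _ ↦ hderiv x) (Continuous.intervalIntegrable (by fun_prop) _ _)
    rw [intervalIntegral.integral_sub (Continuous.intervalIntegrable (by fun_prop) _ _)
      (hφc.intervalIntegrable _ _), hφa] at h
    simp only [zero_mul, neg_zero, sub_zero] at h
    linarith
  have hint : Integrable fun x ↦ φ x * min (x ^ 2 / a ^ 2) 1 := by
    refine hφint.mul_bdd (c := 1) (by fun_prop) (.of_forall fun x ↦ ?_)
    rw [norm_of_nonneg (by positivity)]
    exact min_le_right _ _
  have hin : ∫ x in Set.Ioc 0 a, φ x * min (x ^ 2 / a ^ 2) 1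
      = (1 / 2 - gaussQ a - a * φ a) / a ^ 2 := by
    rw [← hsq, ← intervalIntegral.integral_div, intervalIntegral.integral_of_le ha.le]
    refine setIntegral_congr_fun measurableSet_Ioc fun x hx ↦ ?_
    have : x ^ 2 / a ^ 2 ≤ 1 :=
      (div_le_one (by positivity)).2 (pow_le_pow_left₀ hx.1.le hx.2 2)
    simp only [min_eq_left this]
    ring
  have hout : ∫ x in Set.Ioi a, φ x * min (x ^ 2 / a ^ 2) 1 = gaussQ a := by
    refine setIntegral_congr_fun measurableSet_Ioi fun x hx ↦ ?_
    have : 1 ≤ x ^ 2 / a ^ 2 :=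
      (one_le_div (by positivity)).2 (pow_le_pow_left₀ ha.le (le_of_lt hx) 2)
    simp only [min_eq_right this, mul_one, hφ]
  have hsymm := integral_comp_abs (f := fun x ↦ φ x * min (x ^ 2 / a ^ 2) 1)
  simp only [hφeven, sq_abs] at hsymm
  rw [integral_gaussianReal_eq_integral_smul one_ne_zero]
  simp only [hpdf, smul_eq_mul]
  rw [hsymm, ← Set.Ioc_union_Ioi_eq_Ioi ha.le, setIntegral_union
    (Set.Ioc_disjoint_Ioi le_rfl) measurableSet_Ioi hint.integrableOn hint.integrableOn,
    hin, hout, sFun]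
  have hsqrt : √(2 / (π * a ^ 2)) = 2 * (√(2 * π))⁻¹ / a := by
    rw [Real.sqrt_eq_iff_eq_sq (by positivity) (by positivity), div_pow, mul_pow, inv_pow,
      Real.sq_sqrt (by positivity)]
    field_simp
  rw [hsqrt]
  simp only [hφ]
  field_simp

theorem integral_min_sq_div_gaussianReal {v : ℝ≥0} (hv : 0 < v) {χ : ℝ} (hχ : 0 < χ) :
    ∫ z, min (z ^ 2 / χ ^ 2) 1 ∂gaussianReal 0 v
      = sFun (χ / √v) + 2 * gaussQ (χ / √v) := by
  have hv' : (0 : ℝ) < v := hv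
  have hmap : gaussianReal 0 v = (gaussianReal 0 1).map (√v * ·) := by
    rw [gaussianReal_map_const_mul, mul_zero, mul_one]
    congr 1
    ext
    exact (Real.sq_sqrt v.2).symm
  rw [← integral_min_sq_div_gaussianReal_zero_one (div_pos hχ (Real.sqrt_pos.2 hv')), hmap,
    integral_map (by fun_prop) (Continuous.aestronglyMeasurable (by fun_prop))]
  congr with z
  congr 1
  field_simp

/-- For a standard Gaussian `t` independent of a
Bernoulli–Gaussian `w`, and `u, χ > 0`,
`E[min((t√u + w)²/χ², 1)] = (1−ρ)[s(χ/√u) + 2Q(χ/√u)]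
  + ρ[s(χ/√(u+σ_w²)) + 2Q(χ/√(u+σ_w²))]`. -/
theorem chihat_fixed_point_expectation (u χ : ℝ) (hu : 0 < u) (hχ : 0 < χ)
    (σw2 : ℝ≥0) (hσ : 0 < σw2) (ρ : ℝ) (hρ0 : 0 ≤ ρ) (hρ1 : ρ ≤ 1)
    {Ω : Type*} [MeasureSpace Ω] [IsProbabilityMeasure (ℙ : Measure Ω)]
    (t w : Ω → ℝ) (ht : Measurable t) (hw : Measurable w)
    (hindep : IndepFun t w ℙ)
    (hlawt : Measure.map t ℙ = gaussianReal 0 1)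
    (hlaww : Measure.map w ℙ = bernoulliGaussian ρ σw2) :
    ∫ ω, min ((t ω * Real.sqrt u + w ω) ^ 2 / χ ^ 2) 1
      = (1 - ρ) * (sFun (χ / Real.sqrt u) + 2 * gaussQ (χ / Real.sqrt u))
        + ρ * (sFun (χ / Real.sqrt (u + (σw2 : ℝ)))
            + 2 * gaussQ (χ / Real.sqrt (u + (σw2 : ℝ)))) := by
  have hlawt' : HasLaw (fun ω ↦ t ω * √u) (gaussianReal 0 u.toNNReal) ℙ := by
    convert gaussianReal_mul_const (⟨ht.aemeasurable, hlawt⟩ : HasLaw t _ ℙ) (√u) using 2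
    · simp
    · ext
      simp [Real.sq_sqrt hu.le, hu.le]
  have hind : IndepFun (fun ω ↦ t ω * √u) w ℙ :=
    hindep.comp (φ := fun x ↦ x * √u) (ψ := id) (by fun_prop) measurable_id
  have : IsProbabilityMeasure (bernoulliGaussian ρ σw2) :=
    hlaww ▸ Measure.isProbabilityMeasure_map hw.aemeasurable
  have hsum : Measure.map (fun ω ↦ t ω * √u + w ω) ℙ
      = ENNReal.ofReal (1 - ρ) • gaussianReal 0 u.toNNReal
        + ENNReal.ofReal ρ • gaussianReal 0 (u.toNNReal + σw2) := by
    have h := hind.map_add_eq_map_conv_map₀' hlawt'.aemeasurable hw.aemeasurable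
      (by rw [hlawt'.map_eq]; infer_instance) (by rw [hlaww]; infer_instance)
    rw [hlawt'.map_eq, hlaww, bernoulliGaussian, Measure.conv_add, Measure.conv_smul_right,
      Measure.conv_smul_right, Measure.conv_dirac_zero, gaussianReal_conv_gaussianReal,
      add_zero] at h
    exact h
  have hint (v : ℝ≥0) : Integrable (fun z : ℝ ↦ min (z ^ 2 / χ ^ 2) 1) (gaussianReal 0 v) := by
    refine .of_bound (Continuous.aestronglyMeasurable (by fun_prop)) 1 (.of_forall fun x ↦ ?_)
    rw [norm_of_nonneg (by positivity)]
    exact min_le_right _ _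
  have hu' : 0 < u.toNNReal := Real.toNNReal_pos.2 hu
  rw [← integral_map (f := fun z : ℝ ↦ min (z ^ 2 / χ ^ 2) 1) (φ := fun ω ↦ t ω * √u + w ω)
      (by fun_prop) (Continuous.aestronglyMeasurable (by fun_prop)), hsum,
    integral_add_measure ((hint _).smul_measure ENNReal.ofReal_ne_top)
      ((hint _).smul_measure ENNReal.ofReal_ne_top),
    integral_smul_measure, integral_smul_measure,
    integral_min_sq_div_gaussianReal hu' hχ,
    integral_min_sq_div_gaussianReal (add_pos hu' hσ) hχ,
    ENNReal.toReal_ofReal hρ0, ENNReal.toReal_ofReal (sub_nonneg.2 hρ1), NNReal.coe_add,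
    Real.coe_toNNReal u hu.le, smul_eq_mul, smul_eq_mul]
end
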